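/- arXiv:2505.01987 — 2 statements merged into one kernel-verified Lean document; each statement's English description precedes it below -/
import Mathlib

section
/- Let X_1, X_2, ... satisfy Assumption 1 with conditional mean μ and conditional variance σ². For any [0,1)-valued predictable sequence (λ_i)_{i≥1} with λ_1 > 0 and any [0,1]-valued predictable sequences (μ̂_i)_{i≥1} and (σ̂_i)_{i≥1}, the probability that there exists t ≥ 1 with σ² ∉ [D_t − E_t − R_{t,α/2}, D_t − E_t + R_{t,α/2}] is at most α; that is, (D_t − E_t ± R_{t,α/2}) is a (1−α)-confidence sequence for σ². -/
open MeasureTheory ProbabilityTheory Filter Finset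

/-- `ψ_E(λ) := −log(1−λ) − λ`. -/
noncomputable def psiE (l : ℝ) : ℝ := -Real.log (1 - l) - l

variable {Ω : Type*}

/-- `D_t := (Σ_{i≤t} λ_i (X_i − μ̂_i)²) / (Σ_{i≤t} λ_i)`. -/
noncomputable def Dproc (lam X muhat : ℕ → Ω → ℝ) (t : ℕ) (ω : Ω) : ℝ :=
  (∑ i ∈ Finset.Icc 1 t, lam i ω * (X i ω - muhat i ω)^2) / (∑ i ∈ Finset.Icc 1 t, lam i ω)

/-- `E_t := (Σ_{i≤t} λ_i (μ̂_i − μ)²) / (Σ_{i≤t} λ_i)`. -/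
noncomputable def Eproc (lam muhat : ℕ → Ω → ℝ) (μ : ℝ) (t : ℕ) (ω : Ω) : ℝ :=
  (∑ i ∈ Finset.Icc 1 t, lam i ω * (muhat i ω - μ)^2) / (∑ i ∈ Finset.Icc 1 t, lam i ω)

/-- `R_{t,α} := (log(1/α) + Σ_{i≤t} ψ_E(λ_i)((X_i − μ̂_i)² − σ̂_i²)²) / (Σ_{i≤t} λ_i)`. -/
noncomputable def Rproc (lam X muhat sighat : ℕ → Ω → ℝ) (a : ℝ) (t : ℕ) (ω : Ω) : ℝ :=
  (Real.log (1/a) + ∑ i ∈ Finset.Icc 1 t,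
      psiE (lam i ω) * ((X i ω - muhat i ω)^2 - (sighat i ω)^2)^2) /
    (∑ i ∈ Finset.Icc 1 t, lam i ω)

lemma fan_ineq {l x : ℝ} (hl0 : 0 ≤ l) (hl1 : l < 1) (hx : |x| ≤ 1) :
    Real.exp (l * x - psiE l * x ^ 2) ≤ 1 + l * x := by
  have hlx : |-(l * x)| < 1 := by
    rw [abs_neg, abs_mul, abs_of_nonneg hl0]
    nlinarith [abs_nonneg x]
  have h1 := Real.hasSum_pow_div_log_of_abs_lt_one hlx
  have h2 := (Real.hasSum_pow_div_log_of_abs_lt_one (x := l)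
    (by rwa [abs_of_nonneg hl0])).mul_left (x ^ 2)
  rw [← hasSum_nat_add_iff' 1] at h1 h2
  have h3 := hasSum_le (fun n => ?_) h1 h2
  · simp at h3
    have hpos : 0 < 1 + l * x := by
      have := (abs_lt.1 hlx).2
      linarith
    rw [← Real.le_log_iff_exp_le hpos]
    unfold psiE
    nlinarith
  · have e : x ^ 2 * (l ^ (n + 1 + 1) / ((↑(n + 1) : ℝ) + 1))
        = (x ^ 2 * l ^ (n + 1 + 1)) / ((↑(n + 1) : ℝ) + 1) := by ring
    rw [e]
    gcongr
    have : (-(l * x)) ^ (n + 1 + 1) ≤ |x| ^ (n + 1 + 1) * l ^ (n + 1 + 1) := by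
      refine (le_abs_self _).trans (le_of_eq ?_)
      rw [abs_pow, abs_neg, abs_mul, abs_of_nonneg hl0, mul_pow, mul_comm]
    refine this.trans ?_
    gcongr
    rw [← sq_abs x]
    exact pow_le_pow_of_le_one (abs_nonneg x) hx (by omega)

lemma ville {m0 : MeasurableSpace Ω} (P : Measure Ω) [IsProbabilityMeasure P]
    (ℱ : Filtration ℕ m0) (M : ℕ → Ω → ℝ) (hM : Supermartingale M ℱ P)
    (h0 : ∀ n ω, 0 ≤ M n ω) (hM0 : ∀ ω, M 0 ω = 1) (a : ℝ) (ha : 0 < a) :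
    P {ω | ∃ n, a ≤ M n ω} ≤ ENNReal.ofReal (1 / a) := by
  set A : ℕ → Set Ω := fun n => {ω | ∃ k ≤ n, a ≤ M k ω} with hA
  have hmeas : ∀ n, MeasurableSet[ℱ n] (A n) := by
    intro n
    have : A n = ⋃ k ∈ Set.Iic n, {ω | a ≤ M k ω} := by
      ext ω; simp [hA]
    rw [this]
    refine MeasurableSet.biUnion (Set.to_countable _) (fun k hk => ?_)
    exact (((hM.1 k).mono (ℱ.mono hk)).measurable) measurableSet_Ici
  have hmeas0 : ∀ n, MeasurableSet (A n) := fun n => ℱ.le n _ (hmeas n)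
  have key : ∀ n, a * P.real (A n) + ∫ ω in (A n)ᶜ, M n ω ∂P ≤ 1 := by
    intro n
    induction n with
    | zero =>
      by_cases h : a ≤ 1
      · have : A 0 = Set.univ := by ext ω; simp [hA, hM0, h]
        simp [this, h]
      · have : A 0 = ∅ := by ext ω; simp [hA, hM0, not_le.1 h]
        simp [this, hM0]
    | succ n ih =>
      set B : Set Ω := (A n)ᶜ ∩ A (n + 1) with hB
      have hBm : MeasurableSet B := (hmeas0 n).compl.inter (hmeas0 (n + 1))
      have hsub : A n ⊆ A (n + 1) := fun ω ⟨k, hk, h⟩ => ⟨k, by omega, h⟩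
      have e1 : A (n + 1) = A n ∪ B := by
        ext ω
        constructor
        · intro h
          by_cases h' : ω ∈ A n
          · exact Or.inl h'
          · exact Or.inr ⟨h', h⟩
        · rintro (h | h)
          · exact hsub h
          · exact h.2
      have hd : Disjoint (A n) B := by
        rw [Set.disjoint_left]; intro ω h h'; exact h'.1 h
      have e2 : P.real (A (n + 1)) = P.real (A n) + P.real B := by
        rw [e1]; exact measureReal_union hd hBm
      have e3 : (A n)ᶜ = B ∪ (A (n + 1))ᶜ := by
        ext ω
        constructor
        · intro h
          by_cases h' : ω ∈ A (n + 1)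
          · exact Or.inl ⟨h, h'⟩
          · exact Or.inr h'
        · rintro (h | h)
          · exact h.1
          · exact fun h' => h (hsub h')
      have hd2 : Disjoint B (A (n + 1))ᶜ := by
        rw [Set.disjoint_left]; intro ω h h'; exact h' h.2
      have hi := hM.integrable (n + 1)
      have e4 : ∫ ω in (A n)ᶜ, M (n + 1) ω ∂P
          = ∫ ω in B, M (n + 1) ω ∂P + ∫ ω in (A (n + 1))ᶜ, M (n + 1) ω ∂P := by
        rw [e3]
        exact setIntegral_union hd2 (hmeas0 _).compl hi.integrableOn hi.integrableOn
      have e5 : a * P.real B ≤ ∫ ω in B, M (n + 1) ω ∂P := by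
        refine setIntegral_ge_of_const_le_real hBm (measure_ne_top _ _) ?_ hi.integrableOn
        rintro ω ⟨h1, k, hk, h2⟩
        rcases Nat.lt_or_ge k (n + 1) with h | h
        · exact absurd ⟨k, by omega, h2⟩ h1
        · have : k = n + 1 := by omega
          rwa [this] at h2
      have e6 : ∫ ω in (A n)ᶜ, M (n + 1) ω ∂P ≤ ∫ ω in (A n)ᶜ, M n ω ∂P :=
        hM.setIntegral_le (Nat.le_succ n) (hmeas n).compl
      rw [e2]
      linarith
  have bound : ∀ n, P (A n) ≤ ENNReal.ofReal (1 / a) := by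
    intro n
    have h1 : 0 ≤ ∫ ω in (A n)ᶜ, M n ω ∂P := integral_nonneg (fun ω => h0 n ω)
    have h2 : P.real (A n) ≤ 1 / a := by
      rw [le_div_iff₀ ha]; linarith [key n]
    rw [← ofReal_measureReal]
    exact ENNReal.ofReal_le_ofReal h2
  have hU : {ω | ∃ n, a ≤ M n ω} = ⋃ n, A n := by
    ext ω
    simp only [hA, Set.mem_ofPred_eq, Set.mem_iUnion]
    exact ⟨fun ⟨n, h⟩ => ⟨n, n, le_rfl, h⟩, fun ⟨_, k, _, h⟩ => ⟨k, h⟩⟩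
  have hmono : Monotone A := fun i j hij ω ⟨k, hk, h⟩ => ⟨k, hk.trans hij, h⟩
  rw [hU, hmono.measure_iUnion]
  exact iSup_le bound

/-- Conditional expectation of an affine expression with bounded predictable coefficients. -/
lemma condExp_affine {m m0 : MeasurableSpace Ω} (hm : m ≤ m0) (P : Measure[m0] Ω)
    [IsProbabilityMeasure P] (A B C U V : Ω → ℝ) (u v : ℝ)
    (hA : StronglyMeasurable[m] A) (hB : StronglyMeasurable[m] B) (hC : StronglyMeasurable[m] C)
    (K : ℝ) (hAb : ∀ᵐ ω ∂P, |A ω| ≤ K) (hBb : ∀ᵐ ω ∂P, |B ω| ≤ K) (hCb : ∀ᵐ ω ∂P, |C ω| ≤ K)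
    (hU : Integrable U P) (hV : Integrable V P)
    (hu : P[U|m] =ᵐ[P] fun _ => u) (hv : P[V|m] =ᵐ[P] fun _ => v) :
    Integrable (A + (B * U + C * V)) P ∧
    P[A + (B * U + C * V)|m] =ᵐ[P] fun ω => A ω + (B ω * u + C ω * v) := by
  have iA : Integrable A P := Integrable.of_bound (hA.mono hm).aestronglyMeasurable K hAb
  have iB : Integrable (B * U) P := hU.bdd_mul (hB.mono hm).aestronglyMeasurable hBb
  have iC : Integrable (C * V) P := hV.bdd_mul (hC.mono hm).aestronglyMeasurable hCb
  refine ⟨iA.add (iB.add iC), ?_⟩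
  filter_upwards [condExp_add iA (iB.add iC) m, condExp_add iB iC m,
    condExp_mul_of_stronglyMeasurable_left hB iB hU,
    condExp_mul_of_stronglyMeasurable_left hC iC hV, hu, hv] with ω h1 h2 h3 h4 h5 h6
  rw [h1, Pi.add_apply, h2, Pi.add_apply, h3, h4, Pi.mul_apply, Pi.mul_apply, h5, h6,
    condExp_of_stronglyMeasurable hm hA iA]

/-- The exponent increment of the process. -/
noncomputable def incr (lam X muhat sighat : ℕ → Ω → ℝ) (μ σ2 s : ℝ) (i : ℕ) (ω : Ω) : ℝ :=
  s * (lam i ω * ((X i ω - muhat i ω)^2 - (σ2 + (muhat i ω - μ)^2)))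
    - psiE (lam i ω) * ((X i ω - muhat i ω)^2 - (sighat i ω)^2)^2

noncomputable def Mproc (lam X muhat sighat : ℕ → Ω → ℝ) (μ σ2 s : ℝ) (t : ℕ) (ω : Ω) : ℝ :=
  Real.exp (∑ i ∈ Finset.Icc 1 t, incr lam X muhat sighat μ σ2 s i ω)

lemma Mproc_succ (lam X muhat sighat : ℕ → Ω → ℝ) (μ σ2 s : ℝ) (t : ℕ) (ω : Ω) :
    Mproc lam X muhat sighat μ σ2 s (t + 1) ω = Mproc lam X muhat sighat μ σ2 s t ω *
      Real.exp (incr lam X muhat sighat μ σ2 s (t + 1) ω) := by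
  unfold Mproc
  rw [Finset.sum_Icc_succ_top (by omega), Real.exp_add]

lemma incr_bound {l x m h μ σ2 s : ℝ} (hl : l ∈ Set.Ico (0:ℝ) 1) (hx : x ∈ Set.Icc (0:ℝ) 1)
    (hm : m ∈ Set.Icc (0:ℝ) 1) (hh : h ∈ Set.Icc (0:ℝ) 1) (hs : s = 1 ∨ s = -1) :
    Real.exp (s * (l * ((x - m)^2 - (σ2 + (m - μ)^2))) - psiE l * ((x - m)^2 - h^2)^2)
      ≤ (1 + l * (s * ((x - m)^2 - h^2))) * Real.exp (-(s * (l * (σ2 + (m - μ)^2 - h^2)))) := by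
  obtain ⟨hl0, hl1⟩ := hl
  obtain ⟨hx0, hx1⟩ := hx
  obtain ⟨hm0, hm1⟩ := hm
  obtain ⟨hh0, hh1⟩ := hh
  have hs2 : s ^ 2 = 1 := by rcases hs with rfl | rfl <;> norm_num
  have hb : |s * ((x - m)^2 - h^2)| ≤ 1 := by
    rw [abs_mul]
    have : |s| = 1 := by rcases hs with rfl | rfl <;> norm_num
    rw [this, one_mul, abs_le]
    constructor <;> nlinarith
  have := fan_ineq hl0 hl1 hb
  have e : s * (l * ((x - m)^2 - (σ2 + (m - μ)^2))) - psiE l * ((x - m)^2 - h^2)^2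
      = (l * (s * ((x - m)^2 - h^2)) - psiE l * (s * ((x - m)^2 - h^2))^2)
        + -(s * (l * (σ2 + (m - μ)^2 - h^2))) := by
    rw [mul_pow, hs2]; ring
  rw [e, Real.exp_add]
  gcongr

lemma W_bound {l m h μ σ2 s : ℝ} (hl : l ∈ Set.Ico (0:ℝ) 1)
    (hm : m ∈ Set.Icc (0:ℝ) 1) (hh : h ∈ Set.Icc (0:ℝ) 1) (hs : s = 1 ∨ s = -1) :
    Real.exp (-(s * (l * (σ2 + (m - μ)^2 - h^2)))) ≤ Real.exp (|σ2| + (1 + |μ|)^2 + 1) := by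
  obtain ⟨hl0, hl1⟩ := hl
  obtain ⟨hm0, hm1⟩ := hm
  obtain ⟨hh0, hh1⟩ := hh
  gcongr
  refine (le_abs_self _).trans ?_
  have h1 : |s| = 1 := by rcases hs with rfl | rfl <;> norm_num
  rw [abs_neg, abs_mul, h1, one_mul, abs_mul, abs_of_nonneg hl0]
  have h2 : |σ2 + (m - μ)^2 - h^2| ≤ |σ2| + (1 + |μ|)^2 + 1 := by
    have h3 : (m - μ)^2 ≤ (1 + |μ|)^2 := by
      apply sq_le_sq'
      · linarith [le_abs_self μ]
      · linarith [neg_abs_le μ]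
    have h4 : h ^ 2 ≤ 1 := by nlinarith
    rw [abs_le]
    constructor <;> nlinarith [le_abs_self σ2, neg_abs_le σ2, sq_nonneg (m - μ), sq_nonneg h]
  nlinarith [abs_nonneg (σ2 + (m - μ)^2 - h^2)]

lemma Mproc_supermartingale
    {m0 : MeasurableSpace Ω} (P : Measure Ω) [IsProbabilityMeasure P]
    (ℱ : Filtration ℕ m0) (X muhat sighat lam : ℕ → Ω → ℝ) (μ σ2 s : ℝ)
    (hs : s = 1 ∨ s = -1)
    (hadapt : Adapted ℱ X)
    (hint : ∀ t, 1 ≤ t → Integrable (X t) P)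
    (hbdd : ∀ t, 1 ≤ t → ∀ᵐ ω ∂P, X t ω ∈ Set.Icc (0:ℝ) 1)
    (hmean : ∀ t, 1 ≤ t → P[X t|ℱ (t - 1)] =ᵐ[P] fun _ => μ)
    (hvar : ∀ t, 1 ≤ t → P[(fun ω => (X t ω - μ)^2)|ℱ (t - 1)] =ᵐ[P] fun _ => σ2)
    (hmu_pred : ∀ t, 1 ≤ t → StronglyMeasurable[ℱ (t - 1)] (muhat t))
    (hmu_mem : ∀ t, 1 ≤ t → ∀ ω, muhat t ω ∈ Set.Icc (0:ℝ) 1)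
    (hsig_pred : ∀ t, 1 ≤ t → StronglyMeasurable[ℱ (t - 1)] (sighat t))
    (hsig_mem : ∀ t, 1 ≤ t → ∀ ω, sighat t ω ∈ Set.Icc (0:ℝ) 1)
    (hlam_pred : ∀ t, 1 ≤ t → StronglyMeasurable[ℱ (t - 1)] (lam t))
    (hlam_mem : ∀ t, 1 ≤ t → ∀ ω, lam t ω ∈ Set.Ico (0:ℝ) 1) :
    Supermartingale (Mproc lam X muhat sighat μ σ2 s) ℱ P := by
  set K : ℝ := Real.exp (|σ2| + (1 + |μ|)^2 + 1) with hK
  have hMpos : ∀ n ω, 0 < Mproc lam X muhat sighat μ σ2 s n ω := fun n ω => Real.exp_pos _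
  have hMb : ∀ n, ∀ᵐ ω ∂P, Mproc lam X muhat sighat μ σ2 s n ω ≤ (2 * K) ^ n := by
    intro n
    induction n with
    | zero => exact Eventually.of_forall (fun ω => by simp [Mproc])
    | succ n ih =>
      filter_upwards [ih, hbdd (n + 1) (by omega)] with ω h1 h2
      rw [Mproc_succ, pow_succ]
      have hl := hlam_mem (n + 1) (by omega) ω
      have hm := hmu_mem (n + 1) (by omega) ω
      have hh := hsig_mem (n + 1) (by omega) ω
      refine mul_le_mul h1 ?_ (Real.exp_pos _).le (by positivity)
      refine (incr_bound hl h2 hm hh hs).trans ?_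
      refine mul_le_mul ?_ (W_bound hl hm hh hs) (Real.exp_pos _).le (by norm_num)
      have : s * ((X (n + 1) ω - muhat (n + 1) ω) ^ 2 - sighat (n + 1) ω ^ 2) ≤ 1 := by
        obtain ⟨a1, a2⟩ := h2
        obtain ⟨a3, a4⟩ := hm
        obtain ⟨a5, a6⟩ := hh
        rcases hs with rfl | rfl <;> nlinarith
      nlinarith [hl.1, hl.2]
  have hpsi : Measurable psiE := by unfold psiE; fun_prop
  have hincr : ∀ n i, 1 ≤ i → i ≤ n →
      Measurable[ℱ n] (incr lam X muhat sighat μ σ2 s i) := by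
    intro n i hi hin
    have a1 : Measurable[ℱ n] (X i) := (hadapt i).mono (ℱ.mono hin) le_rfl
    have a2 : Measurable[ℱ n] (muhat i) :=
      ((hmu_pred i hi).mono (ℱ.mono (by omega))).measurable
    have a3 : Measurable[ℱ n] (sighat i) :=
      ((hsig_pred i hi).mono (ℱ.mono (by omega))).measurable
    have a4 : Measurable[ℱ n] (lam i) :=
      ((hlam_pred i hi).mono (ℱ.mono (by omega))).measurable
    have a5 : Measurable[ℱ n] (fun ω => psiE (lam i ω)) := hpsi.comp a4
    unfold incr
    fun_prop
  have hMm : ∀ n, Measurable[ℱ n] (Mproc lam X muhat sighat μ σ2 s n) := by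
    intro n
    unfold Mproc
    refine Real.measurable_exp.comp ?_
    refine Finset.measurable_fun_sum _ (fun i hi => ?_)
    rw [Finset.mem_Icc] at hi
    exact hincr n i hi.1 hi.2
  have hMi : ∀ n, Integrable (Mproc lam X muhat sighat μ σ2 s n) P := by
    intro n
    refine Integrable.of_bound
      ((hMm n).mono (ℱ.le n) le_rfl).aestronglyMeasurable ((2 * K) ^ n) ?_
    filter_upwards [hMb n] with ω h
    rw [Real.norm_eq_abs, abs_of_pos (hMpos n ω)]
    exact h
  refine supermartingale_nat (fun n => (hMm n).stronglyMeasurable) hMi (fun n => ?_)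
  have hX := hint (n + 1) (by omega)
  have hXm := hmean (n + 1) (by omega)
  have hXv := hvar (n + 1) (by omega)
  have hXb := hbdd (n + 1) (by omega)
  have hl := hlam_mem (n + 1) (by omega)
  have hm := hmu_mem (n + 1) (by omega)
  have hh := hsig_mem (n + 1) (by omega)
  have ml := (hlam_pred (n + 1) (by omega)).measurable
  have mm := (hmu_pred (n + 1) (by omega)).measurable
  have mh := (hsig_pred (n + 1) (by omega)).measurable
  simp only [Nat.add_sub_cancel] at hXm hXv ml mm mh
  have mM := hMm n
  set N := Mproc lam X muhat sighat μ σ2 s n with hN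
  set Y := X (n + 1) with hY
  set l := lam (n + 1) with hldef
  set m := muhat (n + 1) with hmdef
  set h := sighat (n + 1) with hhdef
  set W : Ω → ℝ := fun ω => N ω * Real.exp (-(s * (l ω * (σ2 + (m ω - μ)^2 - h ω^2)))) with hW
  have mW : Measurable[ℱ n] W := by
    rw [hW]; fun_prop
  have bW : ∀ᵐ ω ∂P, 0 ≤ W ω ∧ W ω ≤ (2 * K) ^ n * K := by
    filter_upwards [hMb n] with ω h1
    refine ⟨by have := hMpos n ω; positivity, ?_⟩
    exact mul_le_mul h1 (W_bound (hl ω) (hm ω) (hh ω) hs) (Real.exp_pos _).le (by positivity)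
  -- coefficients
  set A : Ω → ℝ := fun ω => W ω * (1 + l ω * (s * ((μ - m ω)^2 - h ω^2))) with hA
  set B : Ω → ℝ := fun ω => W ω * (l ω * s) with hB
  set C : Ω → ℝ := fun ω => W ω * (l ω * s * (2 * (μ - m ω))) with hC
  have mA : Measurable[ℱ n] A := by rw [hA]; fun_prop
  have mB : Measurable[ℱ n] B := by rw [hB]; fun_prop
  have mC : Measurable[ℱ n] C := by rw [hC]; fun_prop
  have hsabs : |s| = 1 := by rcases hs with rfl | rfl <;> norm_num
  set L : ℝ := (1 + |μ|)^2 + 2 with hL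
  have hbase : ∀ ω, |1 + l ω * (s * ((μ - m ω)^2 - h ω^2))| ≤ L ∧ |l ω * s| ≤ L ∧
      |l ω * s * (2 * (μ - m ω))| ≤ L := by
    intro ω
    obtain ⟨l0, l1⟩ := hl ω
    obtain ⟨m0', m1⟩ := hm ω
    obtain ⟨h0', h1'⟩ := hh ω
    have d : |μ - m ω| ≤ 1 + |μ| := by
      rw [abs_le]; constructor <;> linarith [le_abs_self μ, neg_abs_le μ]
    have d2 : (μ - m ω)^2 ≤ (1 + |μ|)^2 := by
      rw [← sq_abs (μ - m ω)]
      gcongr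
    have hls : |l ω * s| ≤ 1 := by
      rw [abs_mul, hsabs, abs_of_nonneg l0]; linarith
    refine ⟨?_, ?_, ?_⟩
    · refine (abs_add_le _ _).trans ?_
      rw [← mul_assoc, abs_mul, abs_one]
      have : |(μ - m ω)^2 - h ω^2| ≤ (1 + |μ|)^2 + 1 := by
        rw [abs_le]
        constructor <;> nlinarith [sq_nonneg (μ - m ω), sq_nonneg (h ω)]
      nlinarith [abs_nonneg ((μ - m ω)^2 - h ω^2)]
    · nlinarith [abs_nonneg μ]
    · rw [abs_mul, abs_mul 2, abs_two]
      have h5 : |l ω * s| * (2 * |μ - m ω|) ≤ 1 * (2 * (1 + |μ|)) := by gcongr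
      nlinarith [abs_nonneg μ, sq_nonneg |μ|]
  have iU : Integrable (fun ω => (Y ω - μ)^2) P := by
    refine Integrable.of_bound ((hX.aestronglyMeasurable.sub
      aestronglyMeasurable_const).pow 2) ((1 + |μ|)^2) ?_
    filter_upwards [hXb] with ω hω
    rw [Real.norm_eq_abs, abs_of_nonneg (sq_nonneg _)]
    apply sq_le_sq'
    · linarith [le_abs_self μ, hω.1]
    · linarith [neg_abs_le μ, hω.2]
  have iV : Integrable (Y - fun _ => μ) P := hX.sub (integrable_const μ)
  have hV : P[Y - fun _ => μ|ℱ n] =ᵐ[P] fun _ => (0 : ℝ) := by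
    filter_upwards [condExp_sub hX (integrable_const μ) (ℱ n), hXm] with ω h1 h2
    rw [h1, Pi.sub_apply, h2, condExp_const (ℱ.le n)]
    simp
  have hbd : ∀ F : Ω → ℝ, (∀ ω, |F ω| ≤ L) →
      ∀ᵐ ω ∂P, |W ω * F ω| ≤ (2 * K) ^ n * K * L := by
    intro F hF
    filter_upwards [bW] with ω h1
    rw [abs_mul, abs_of_nonneg h1.1]
    exact mul_le_mul h1.2 (hF ω) (abs_nonneg _) (h1.1.trans h1.2)
  obtain ⟨iT, hT⟩ := condExp_affine (ℱ.le n) P A B C (fun ω => (Y ω - μ)^2) (Y - fun _ => μ) σ2 0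
    mA.stronglyMeasurable mB.stronglyMeasurable mC.stronglyMeasurable ((2 * K) ^ n * K * L)
    (hbd _ (fun ω => (hbase ω).1)) (hbd _ (fun ω => (hbase ω).2.1))
    (hbd _ (fun ω => (hbase ω).2.2)) iU iV hXv hV
  have hle : Mproc lam X muhat sighat μ σ2 s (n + 1) ≤ᵐ[P]
      A + (B * (fun ω => (Y ω - μ)^2) + C * (Y - fun _ => μ)) := by
    filter_upwards [hXb] with ω hω
    rw [Mproc_succ]
    have h1 := incr_bound (μ := μ) (σ2 := σ2) (hl ω) hω (hm ω) (hh ω) hs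
    refine (mul_le_mul_of_nonneg_left h1 (hMpos n ω).le).trans (le_of_eq ?_)
    simp only [Pi.add_apply, Pi.mul_apply, Pi.sub_apply, hA, hB, hC, hW, hN]
    ring
  filter_upwards [condExp_mono (m := ℱ n) (hMi (n + 1)) iT hle, hT] with ω h1 h2
  refine h1.trans ?_
  rw [h2]
  have e : A ω + (B ω * σ2 + C ω * 0) = N ω *
      (Real.exp (-(s * (l ω * (σ2 + (m ω - μ)^2 - h ω^2)))) *
        (s * (l ω * (σ2 + (m ω - μ)^2 - h ω^2)) + 1)) := by
    simp only [hA, hB, hC, hW]; ring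
  rw [e]
  refine mul_le_of_le_one_right (hMpos n ω).le ?_
  refine (mul_le_mul_of_nonneg_left (Real.add_one_le_exp _) (Real.exp_pos _).le).trans ?_
  rw [← Real.exp_add, neg_add_cancel, Real.exp_zero]

/-- Corollary 1 of the paper: `(D_t − E_t ± R_{t,α/2})` is a `(1−α)`-confidence
sequence for the variance `σ²`. -/
theorem variance_confidence_sequence
    {m0 : MeasurableSpace Ω} (P : Measure Ω) [IsProbabilityMeasure P]
    (ℱ : Filtration ℕ m0) (X muhat sighat lam : ℕ → Ω → ℝ) (μ σ2 α : ℝ)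
    (hα : α ∈ Set.Ioo (0:ℝ) 1)
    (hadapt : Adapted ℱ X)
    (hint : ∀ t, 1 ≤ t → Integrable (X t) P)
    (hbdd : ∀ t, 1 ≤ t → ∀ᵐ ω ∂P, X t ω ∈ Set.Icc (0:ℝ) 1)
    (hmean : ∀ t, 1 ≤ t → P[X t|ℱ (t - 1)] =ᵐ[P] fun _ => μ)
    (hvar : ∀ t, 1 ≤ t → P[(fun ω => (X t ω - μ)^2)|ℱ (t - 1)] =ᵐ[P] fun _ => σ2)
    (hmu_pred : ∀ t, 1 ≤ t → StronglyMeasurable[ℱ (t - 1)] (muhat t))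
    (hmu_mem : ∀ t, 1 ≤ t → ∀ ω, muhat t ω ∈ Set.Icc (0:ℝ) 1)
    (hsig_pred : ∀ t, 1 ≤ t → StronglyMeasurable[ℱ (t - 1)] (sighat t))
    (hsig_mem : ∀ t, 1 ≤ t → ∀ ω, sighat t ω ∈ Set.Icc (0:ℝ) 1)
    (hlam_pred : ∀ t, 1 ≤ t → StronglyMeasurable[ℱ (t - 1)] (lam t))
    (hlam_mem : ∀ t, 1 ≤ t → ∀ ω, lam t ω ∈ Set.Ico (0:ℝ) 1)
    (hlam_pos : ∀ ω, 0 < lam 1 ω) :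
    P {ω | ∃ t, 1 ≤ t ∧
        σ2 ∉ Set.Icc
          (Dproc lam X muhat t ω - Eproc lam muhat μ t ω - Rproc lam X muhat sighat (α/2) t ω)
          (Dproc lam X muhat t ω - Eproc lam muhat μ t ω + Rproc lam X muhat sighat (α/2) t ω)}
      ≤ ENNReal.ofReal α := by
  have hα0 := hα.1
  have hV : ∀ s : ℝ, s = 1 ∨ s = -1 →
      P {ω | ∃ n, 2 / α ≤ Mproc lam X muhat sighat μ σ2 s n ω} ≤ ENNReal.ofReal (α / 2) := by
    intro s hs
    have := ville P ℱ _ (Mproc_supermartingale P ℱ X muhat sighat lam μ σ2 s hs hadapt hint hbdd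
      hmean hvar hmu_pred hmu_mem hsig_pred hsig_mem hlam_pred hlam_mem)
      (fun n ω => (Real.exp_pos _).le) (fun ω => by simp [Mproc]) (2 / α) (by positivity)
    rwa [one_div_div] at this
  have hsub : {ω | ∃ t, 1 ≤ t ∧
        σ2 ∉ Set.Icc
          (Dproc lam X muhat t ω - Eproc lam muhat μ t ω - Rproc lam X muhat sighat (α/2) t ω)
          (Dproc lam X muhat t ω - Eproc lam muhat μ t ω + Rproc lam X muhat sighat (α/2) t ω)}
      ⊆ {ω | ∃ n, 2 / α ≤ Mproc lam X muhat sighat μ σ2 1 n ω} ∪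
        {ω | ∃ n, 2 / α ≤ Mproc lam X muhat sighat μ σ2 (-1) n ω} := by
    rintro ω ⟨t, ht, hω⟩
    have hS : 0 < ∑ i ∈ Finset.Icc 1 t, lam i ω := by
      refine Finset.sum_pos' (fun i hi => (hlam_mem i (Finset.mem_Icc.1 hi).1 ω).1)
        ⟨1, Finset.mem_Icc.2 ⟨le_rfl, ht⟩, hlam_pos ω⟩
    have hexp : ∀ s : ℝ, ∑ i ∈ Finset.Icc 1 t, incr lam X muhat sighat μ σ2 s i ω =
        s * (∑ i ∈ Finset.Icc 1 t, lam i ω * (X i ω - muhat i ω)^2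
          - ∑ i ∈ Finset.Icc 1 t, lam i ω * (muhat i ω - μ)^2
          - σ2 * ∑ i ∈ Finset.Icc 1 t, lam i ω)
        - ∑ i ∈ Finset.Icc 1 t, psiE (lam i ω) * ((X i ω - muhat i ω)^2 - (sighat i ω)^2)^2 := by
      intro s
      rw [Finset.mul_sum, ← Finset.sum_sub_distrib, ← Finset.sum_sub_distrib, Finset.mul_sum,
        ← Finset.sum_sub_distrib]
      refine Finset.sum_congr rfl (fun i _ => ?_)
      unfold incr
      ring
    have hlog : ∀ s : ℝ, Real.log (1 / (α / 2)) ≤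
        ∑ i ∈ Finset.Icc 1 t, incr lam X muhat sighat μ σ2 s i ω →
        2 / α ≤ Mproc lam X muhat sighat μ σ2 s t ω := by
      intro s h
      rw [one_div_div] at h
      exact (Real.log_le_iff_le_exp (by positivity)).1 h
    rw [Set.mem_Icc, not_and_or, not_le, not_le] at hω
    unfold Dproc Eproc Rproc at hω
    rw [← sub_div, ← sub_div, ← add_div, lt_div_iff₀ hS, div_lt_iff₀ hS] at hω
    rcases hω with h | h
    · left
      refine ⟨t, hlog 1 ?_⟩
      rw [hexp]; linarith
    · right
      refine ⟨t, hlog (-1) ?_⟩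
      rw [hexp]; linarith
  calc _ ≤ _ := measure_mono hsub
    _ ≤ _ := measure_union_le _ _
    _ ≤ ENNReal.ofReal (α / 2) + ENNReal.ofReal (α / 2) :=
      add_le_add (hV 1 (Or.inl rfl)) (hV (-1) (Or.inr rfl))
    _ = ENNReal.ofReal α := by
      rw [← ENNReal.ofReal_add (by positivity) (by positivity), add_halves]
end

section
/- Let X_1, X_2, ... satisfy Assumption 1 and Assumption 2, and let (δ_n)_{n≥1} be a deterministic sequence with δ_n > 0 and δ_n increasing to δ > 0. With the batch plug-ins λ_{i,δ_n} := min( sqrt( 2 log(1/δ_n) / (m̂²_{4,i} · n) ), c_1 ) and the estimators μ̂, σ̂², m̂²_4 defined in the context (with c_2 > 0 and c_3 > 0), the rescaled width satisfies √n · R_{n,δ_n} → sqrt( 2 V log(1/δ) ) almost surely as n → ∞, where V := Var((X_i − μ)²) is the common conditional variance of (X_i − μ)² and R_{n,δ_n} := (log(1/δ_n) + Σ_{i≤n} ψ_E(λ_{i,δ_n})((X_i − μ̂_i)² − σ̂_i²)²)/(Σ_{i≤n} λ_{i,δ_n}). -/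
open MeasureTheory ProbabilityTheory Filter Finset

variable {Ω : Type*}

/-- `μ̂_t := (c₄ + Σ_{i≤t−1} X_i)/t`. -/
noncomputable def muHat (c4 : ℝ) (X : ℕ → Ω → ℝ) (t : ℕ) (ω : Ω) : ℝ :=
  (c4 + ∑ i ∈ Finset.Icc 1 (t-1), X i ω) / (t : ℝ)

/-- `σ̂_t² := (c₃ + Σ_{i≤t−1}(X_i − μ̂_i)²)/t`. -/
noncomputable def sigHat2 (c3 c4 : ℝ) (X : ℕ → Ω → ℝ) (t : ℕ) (ω : Ω) : ℝ :=
  (c3 + ∑ i ∈ Finset.Icc 1 (t-1), (X i ω - muHat c4 X i ω)^2) / (t : ℝ)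

/-- `m̂²_{4,t} := (c₂ + Σ_{i≤t−1} [(X_i − μ̂_i)² − σ̂_i²]²)/t`. -/
noncomputable def m4Hat2 (c2 c3 c4 : ℝ) (X : ℕ → Ω → ℝ) (t : ℕ) (ω : Ω) : ℝ :=
  (c2 + ∑ i ∈ Finset.Icc 1 (t-1),
      ((X i ω - muHat c4 X i ω)^2 - sigHat2 c3 c4 X i ω)^2) / (t : ℝ)

/-- Batch plug-in `λ_{i,d} := min(√(2 log(1/d)/(m̂²_{4,i} n)), c₁)`. -/
noncomputable def lamB (c1 c2 c3 c4 : ℝ) (X : ℕ → Ω → ℝ) (d : ℝ) (n i : ℕ) (ω : Ω) : ℝ :=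
  min (Real.sqrt (2 * Real.log (1/d) / (m4Hat2 c2 c3 c4 X i ω * (n : ℝ)))) c1

/-- `R_{n,d}` computed with the batch plug-ins and the running estimators. -/
noncomputable def RB (c1 c2 c3 c4 : ℝ) (X : ℕ → Ω → ℝ) (d : ℝ) (n : ℕ) (ω : Ω) : ℝ :=
  (Real.log (1/d) + ∑ i ∈ Finset.Icc 1 n,
      psiE (lamB c1 c2 c3 c4 X d n i ω) *
        ((X i ω - muHat c4 X i ω)^2 - sigHat2 c3 c4 X i ω)^2) /
    (∑ i ∈ Finset.Icc 1 n, lamB c1 c2 c3 c4 X d n i ω)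

lemma aux_psi_nonneg {l : ℝ} (h1 : l < 1) : 0 ≤ psiE l := by
  have := Real.log_le_sub_one_of_pos (sub_pos.2 h1)
  unfold psiE; linarith

lemma aux_psi_two {l : ℝ} (h0 : 0 ≤ l) (h1 : l < 1) :
    |psiE l - l^2/2| ≤ l^3/(1-l) := by
  have := Real.abs_log_sub_add_sum_range_le (x := l) (by rwa [abs_of_nonneg h0]) 2
  rw [abs_of_nonneg h0] at this
  simp only [Finset.sum_range_succ, Finset.sum_range_zero] at this
  norm_num at this
  unfold psiE
  rw [← abs_neg]
  convert this using 2
  ring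

lemma aux_psi_one {l : ℝ} (h0 : 0 ≤ l) (h1 : l < 1) :
    psiE l ≤ l^2/(1-l) := by
  have := Real.abs_log_sub_add_sum_range_le (x := l) (by rwa [abs_of_nonneg h0]) 1
  rw [abs_of_nonneg h0] at this
  simp only [Finset.sum_range_succ, Finset.sum_range_zero] at this
  norm_num at this
  unfold psiE
  have := (abs_le.1 this).1
  linarith

/-- Cesàro averages in the form used below. -/
lemma aux_cesaro {u : ℕ → ℝ} {l : ℝ} (h : Tendsto u atTop (nhds l)) :
    Tendsto (fun n : ℕ => (∑ i ∈ range n, u i) / n) atTop (nhds l) := by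
  refine h.cesaro.congr fun n => ?_
  rw [div_eq_inv_mul]

lemma aux_cesaro_perturb {f g : ℕ → ℝ} {l : ℝ}
    (hf : Tendsto (fun n : ℕ => (∑ i ∈ range n, f i) / n) atTop (nhds l))
    (h : Tendsto (fun i => g i - f i) atTop (nhds 0)) :
    Tendsto (fun n : ℕ => (∑ i ∈ range n, g i) / n) atTop (nhds l) := by
  have := hf.add (aux_cesaro h)
  rw [add_zero] at this
  refine this.congr fun n => ?_
  rw [← add_div, ← Finset.sum_add_distrib]
  simp

lemma aux_shift {f : ℕ → ℝ} {l c : ℝ}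
    (hf : Tendsto (fun n : ℕ => (∑ i ∈ range n, f i) / n) atTop (nhds l)) :
    Tendsto (fun n : ℕ => (c + ∑ i ∈ range n, f i) / ((n:ℝ) + 1)) atTop (nhds l) := by
  have h1 : Tendsto (fun n : ℕ => 1 / ((n:ℝ)+1)) atTop (nhds 0) :=
    tendsto_one_div_add_atTop_nhds_zero_nat
  have h2 : Tendsto (fun n : ℕ => c * (1 / ((n:ℝ)+1)) +
      ((∑ i ∈ range n, f i) / n) * (1 - 1 / ((n:ℝ)+1))) atTop (nhds (c * 0 + l * (1 - 0))) :=
    (h1.const_mul c).add (hf.mul (tendsto_const_nhds.sub h1))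
  rw [mul_zero, zero_add, sub_zero, mul_one] at h2
  refine h2.congr' ?_
  filter_upwards [eventually_gt_atTop 0] with n hn
  have : (n:ℝ) ≠ 0 := by positivity
  have : (n:ℝ)+1 ≠ 0 := by positivity
  field_simp
  ring

lemma aux_pos {c1 c2 V L Lmax B : ℝ} {y m Ls : ℕ → ℝ}
    (hc1 : c1 ∈ Set.Ioo (0:ℝ) 1) (hc2 : 0 < c2)
    (hy0 : ∀ i, 0 ≤ y i) (hyB : ∀ i, y i ≤ B)
    (hav : Tendsto (fun n : ℕ => (∑ i ∈ range n, y i) / n) atTop (nhds V))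
    (hm : ∀ i, m i = (c2 + ∑ j ∈ range i, y j) / ((i:ℝ) + 1))
    (hL0 : ∀ n, 0 < Ls n) (hLm : ∀ n, Ls n ≤ Lmax) (hL : Tendsto Ls atTop (nhds L))
    (hV : 0 < V) :
    Tendsto (fun n : ℕ => √(n:ℝ) * ((Ls n + ∑ i ∈ range n,
        psiE (min √(2 * Ls n / (m i * n)) c1) * y i) /
        ∑ i ∈ range n, min √(2 * Ls n / (m i * n)) c1)) atTop (nhds √(2 * V * L)) := by
  have hmpos : ∀ i, 0 < m i := fun i => by
    rw [hm]; have := Finset.sum_nonneg (s := range i) (fun j _ => hy0 j); positivity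
  have hmlim : Tendsto m atTop (nhds V) := (aux_shift (c := c2) hav).congr fun i => (hm i).symm
  have hinv : Tendsto (fun i => 1 / m i) atTop (nhds (1 / V)) :=
    tendsto_const_nhds.div hmlim hV.ne'
  obtain ⟨K, hK⟩ := hinv.bddAbove_range
  have hK' : ∀ i, 1 / m i ≤ K := fun i => hK ⟨i, rfl⟩
  have hKpos : 0 < K := (by have := hmpos 0; positivity : 0 < 1 / m 0).trans_le (hK' 0)
  have hLmpos : 0 < Lmax := (hL0 0).trans_le (hLm 0)
  have hA : Tendsto (fun n : ℕ => (∑ i ∈ range n, y i / m i) / n) atTop (nhds 1) := by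
    have h1 : Tendsto (fun n : ℕ => (∑ i ∈ range n, y i / V) / n) atTop (nhds 1) := by
      have := hav.div_const V
      rw [div_self hV.ne'] at this
      refine this.congr fun n => ?_
      rw [← Finset.sum_div]; ring
    refine aux_cesaro_perturb h1 ?_
    have h2 : Tendsto (fun i => 1 / m i - 1 / V) atTop (nhds 0) := by
      simpa using hinv.sub_const (1 / V)
    have h3 : Tendsto (fun i => B * |1 / m i - 1 / V|) atTop (nhds 0) := by
      simpa using (h2.abs).const_mul B
    refine squeeze_zero_norm (fun i => ?_) h3
    rw [Real.norm_eq_abs, show y i / m i - y i / V = y i * (1 / m i - 1 / V) by ring, abs_mul,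
      abs_of_nonneg (hy0 i)]
    exact mul_le_mul_of_nonneg_right (hyB i) (abs_nonneg _)
  have hE : Tendsto (fun n : ℕ => (∑ i ∈ range n, 1 / √(m i)) / n) atTop (nhds (1 / √V)) := by
    apply aux_cesaro
    exact tendsto_const_nhds.div hmlim.sqrt (Real.sqrt_pos.2 hV).ne'
  set r : ℕ → ℝ := fun n => √(2 * Lmax * K / n) with hr
  have hrlim : Tendsto r atTop (nhds 0) := by
    have := (tendsto_const_div_atTop_nhds_zero_nat (2 * Lmax * K)).sqrt
    rwa [Real.sqrt_zero] at this
  set e : ℕ → ℝ := fun n => 2 * r n / (1 - r n) with he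
  have helim : Tendsto e atTop (nhds 0) := by
    have := (hrlim.const_mul 2).div (tendsto_const_nhds (x := (1:ℝ)).sub hrlim) (by norm_num)
    rw [mul_zero, zero_div] at this
    exact this
  have hfin : ∀ s : ℝ, Tendsto (fun n => √(Ls n) * (1 + (1 + s * e n) *
      ((∑ i ∈ range n, y i / m i) / n)) / (√2 * ((∑ i ∈ range n, 1 / √(m i)) / n))) atTop
      (nhds √(2 * V * L)) := by
    intro s
    have h2 : √2 * (1 / √V) ≠ 0 := by positivity
    have := ((hL.sqrt).mul ((((helim.const_mul s).const_add 1).mul hA).const_add 1)).div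
      (hE.const_mul √2) h2
    refine Eq.subst (motive := fun z => Tendsto _ atTop (nhds z)) ?_ this
    rw [Real.sqrt_mul (by positivity), Real.sqrt_mul (by positivity)]
    have : √2 * √2 = 2 := Real.mul_self_sqrt (by norm_num)
    field_simp
    norm_num
  have hkey : ∀ᶠ n : ℕ in atTop,
      |√(n:ℝ) * ((Ls n + ∑ i ∈ range n,
        psiE (min √(2 * Ls n / (m i * n)) c1) * y i) /
        ∑ i ∈ range n, min √(2 * Ls n / (m i * n)) c1)
       - √(Ls n) * (1 + (1 + 0 * e n) *
      ((∑ i ∈ range n, y i / m i) / n)) / (√2 * ((∑ i ∈ range n, 1 / √(m i)) / n))| ≤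
      √(Ls n) * (1 + (1 + 1 * e n) *
      ((∑ i ∈ range n, y i / m i) / n)) / (√2 * ((∑ i ∈ range n, 1 / √(m i)) / n)) -
      √(Ls n) * (1 + (1 + 0 * e n) *
      ((∑ i ∈ range n, y i / m i) / n)) / (√2 * ((∑ i ∈ range n, 1 / √(m i)) / n)) := by
    filter_upwards [eventually_gt_atTop 0, hrlim.eventually_lt_const hc1.1] with n hn hrn
    have hn' : (0:ℝ) < n := by exact_mod_cast hn
    have hl := hL0 n
    have hle : ∀ i, √(2 * Ls n / (m i * n)) ≤ r n := fun i => by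
      apply Real.sqrt_le_sqrt
      have hmi := hmpos i
      calc 2 * Ls n / (m i * n) = 2 * Ls n * (1 / m i) / n := by field_simp
        _ ≤ 2 * Lmax * K / n := by
          gcongr
          · exact hLm n
          · exact hK' i
    have hmin : ∀ i, min √(2 * Ls n / (m i * n)) c1 = √(2 * Ls n / (m i * n)) := fun i =>
      min_eq_left ((hle i).trans hrn.le)
    simp only [hmin]
    have hr1 : r n < 1 := hrn.trans hc1.2
    have hr0 : 0 ≤ r n := Real.sqrt_nonneg _
    have hden : ∑ i ∈ range n, √(2 * Ls n / (m i * n)) =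
        √(Ls n) * √n * (√2 * ((∑ i ∈ range n, 1 / √(m i)) / n)) := by
      rw [Finset.sum_div, Finset.mul_sum, Finset.mul_sum]
      refine Finset.sum_congr rfl fun i _ => ?_
      have hmi := hmpos i
      rw [Real.sqrt_div (by positivity), Real.sqrt_mul (by positivity), Real.sqrt_mul hmi.le]
      have : √(n:ℝ) * √n = n := Real.mul_self_sqrt hn'.le
      have h1 := Real.sqrt_pos.2 hn'
      have h2 := Real.sqrt_pos.2 hmi
      field_simp
      nlinarith
    have hterm : ∀ i, |psiE √(2 * Ls n / (m i * n)) * y i - Ls n * (y i / m i) / n| ≤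
        e n * (Ls n * (y i / m i) / n) := fun i => by
      have hmi := hmpos i
      set l := √(2 * Ls n / (m i * n)) with hldef
      have hl0 : 0 ≤ l := Real.sqrt_nonneg _
      have hl2 : l^2 = 2 * Ls n / (m i * n) := Real.sq_sqrt (by positivity)
      have hlr : l ≤ r n := hle i
      have h := aux_psi_two hl0 (hlr.trans_lt hr1)
      have e1 : Ls n * (y i / m i) / n = l^2/2 * y i := by rw [hl2]; field_simp
      rw [e1, ← sub_mul, abs_mul, abs_of_nonneg (hy0 i), ← mul_assoc]
      refine mul_le_mul_of_nonneg_right (h.trans ?_) (hy0 i)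
      have : 0 < 1 - r n := by linarith
      calc l^3/(1-l) = l^2 * (l / (1-l)) := by ring
        _ ≤ l^2 * (r n / (1 - r n)) := by gcongr
        _ = e n * (l^2/2) := by simp only [he]; ring
    have hsum : |∑ i ∈ range n, psiE √(2 * Ls n / (m i * n)) * y i -
        Ls n * ((∑ i ∈ range n, y i / m i) / n)| ≤
        e n * (Ls n * ((∑ i ∈ range n, y i / m i) / n)) := by
      have e1 : Ls n * ((∑ i ∈ range n, y i / m i) / n) =
        ∑ i ∈ range n, Ls n * (y i / m i) / n := by
        rw [Finset.sum_div, Finset.mul_sum]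
        exact Finset.sum_congr rfl fun i _ => by ring
      rw [e1, ← Finset.sum_sub_distrib, Finset.mul_sum]
      exact (Finset.abs_sum_le_sum_abs _ _).trans (Finset.sum_le_sum fun i _ => hterm i)
    rw [hden]
    have hEpos : 0 < (∑ i ∈ range n, 1 / √(m i)) / n := by
      refine div_pos (Finset.sum_pos (fun i _ => ?_) (by simpa using hn.ne')) hn'
      have := hmpos i
      positivity
    generalize (∑ i ∈ range n, 1 / √(m i)) / n = E at *
    generalize (∑ i ∈ range n, y i / m i) / n = A at *
    generalize ∑ i ∈ range n, psiE √(2 * Ls n / (m i * n)) * y i = Q at *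
    have hs := Real.sqrt_pos.2 hl
    have hsn := Real.sqrt_pos.2 hn'
    have hss : √(Ls n) * √(Ls n) = Ls n := Real.mul_self_sqrt hl.le
    have e2 : √(n:ℝ) * ((Ls n + Q) / (√(Ls n) * √n * (√2 * E))) - √(Ls n) * (1 + (1 + 0 * e n) * A) / (√2 * E)
       = (Q - Ls n * A) / (√(Ls n) * (√2 * E)) := by
      have : √2 * E ≠ 0 := by positivity
      generalize √2 * E = F at *
      field_simp
      rw [sq, hss]; ring
    have e3 : √(Ls n) * (1 + (1 + 1 * e n) * A) / (√2 * E) - √(Ls n) * (1 + (1 + 0 * e n) * A) / (√2 * E)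
       = (e n * (Ls n * A)) / (√(Ls n) * (√2 * E)) := by
      have : √2 * E ≠ 0 := by positivity
      generalize √2 * E = F at *
      field_simp
      rw [sq, hss]; ring
    rw [e2, e3, abs_div, abs_of_pos (by positivity : 0 < √(Ls n) * (√2 * E))]
    gcongr
  have hd := (hfin 1).sub (hfin 0)
  rw [sub_self] at hd
  have := (squeeze_zero_norm' hkey hd).add (hfin 0)
  rw [zero_add] at this
  exact this.congr fun n => by ring

lemma aux_zero {c1 c2 Lmax B : ℝ} {y m Ls : ℕ → ℝ}
    (hc1 : c1 ∈ Set.Ioo (0:ℝ) 1) (hc2 : 0 < c2)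
    (hy0 : ∀ i, 0 ≤ y i) (hyB : ∀ i, y i ≤ B)
    (hav : Tendsto (fun n : ℕ => (∑ i ∈ range n, y i) / n) atTop (nhds 0))
    (hm : ∀ i, m i = (c2 + ∑ j ∈ range i, y j) / ((i:ℝ) + 1))
    (hL0 : ∀ n, 0 < Ls n) (hLm : ∀ n, Ls n ≤ Lmax) :
    Tendsto (fun n : ℕ => √(n:ℝ) * ((Ls n + ∑ i ∈ range n,
        psiE (min √(2 * Ls n / (m i * n)) c1) * y i) /
        ∑ i ∈ range n, min √(2 * Ls n / (m i * n)) c1)) atTop (nhds 0) := by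
  have hmpos : ∀ i, 0 < m i := fun i => by
    rw [hm]; have := Finset.sum_nonneg (s := range i) (fun j _ => hy0 j); positivity
  have hmlim : Tendsto m atTop (nhds 0) := (aux_shift (c := c2) hav).congr fun i => (hm i).symm
  have hLmpos : 0 < Lmax := (hL0 0).trans_le (hLm 0)
  have hB0 : 0 ≤ B := (hy0 0).trans (hyB 0)
  have hZ : Tendsto (fun n : ℕ => (∑ i ∈ range n, √(m i)) / n) atTop (nhds 0) := by
    apply aux_cesaro
    simpa using hmlim.sqrt
  set W : ℕ → ℝ := fun n => (∑ i ∈ range n, 1 / √(m i)) / n with hW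
  set A : ℕ → ℝ := fun n => (∑ i ∈ range n, y i / m i) / n with hAdef
  set C : ℝ := 1 + B / c2 with hC
  have hC0 : 0 < C := by positivity
  have hWpos : ∀ n, 0 < n → 0 < W n := fun n hn => by
    refine div_pos (Finset.sum_pos (fun i _ => ?_) (by simpa using hn.ne')) (by exact_mod_cast hn)
    have := hmpos i
    positivity
  have hWinv : Tendsto (fun n => 1 / W n) atTop (nhds 0) := by
    refine squeeze_zero' ?_ ?_ hZ
    · filter_upwards [eventually_gt_atTop 0] with n hn
      have := hWpos n hn
      positivity
    · filter_upwards [eventually_gt_atTop 0] with n hn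
      have hw := hWpos n hn
      have hn' : (0:ℝ) < n := by exact_mod_cast hn
      rw [div_le_iff₀ hw]
      have := Finset.sum_sq_le_sum_mul_sum_of_sq_le_mul (range n) (r := fun _ => (1:ℝ))
        (f := fun i => √(m i)) (g := fun i => 1 / √(m i)) (fun i _ => Real.sqrt_nonneg _)
        (fun i _ => by positivity) (fun i _ => by
          have := Real.sqrt_pos.2 (hmpos i)
          refine le_of_eq ?_
          field_simp)
      simp only [Finset.sum_const, Finset.card_range, nsmul_eq_mul, mul_one] at this
      simp only [hW]
      rw [div_mul_div_comm, le_div_iff₀ (by positivity)]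
      nlinarith
  -- entropy-type bound on `A`
  have hstep : ∀ i, y i / m i ≤ C * (1 + ((i:ℝ) + 1) * (Real.log (m (i+1)) - Real.log (m i))) := by
    intro i
    set T := c2 + ∑ j ∈ range i, y j with hT
    have hTc : c2 ≤ T := by
      have := Finset.sum_nonneg (s := range i) (fun j _ => hy0 j); linarith
    have hT0 : 0 < T := hc2.trans_le hTc
    have hi : (0:ℝ) < (i:ℝ) + 1 := by positivity
    have hi2 : (0:ℝ) < (i:ℝ) + 1 + 1 := by positivity
    have h1 : m (i+1) = (T + y i) / ((i:ℝ) + 1 + 1) := by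
      rw [hm, Finset.sum_range_succ, hT]; push_cast; ring
    have h0 : m i = T / ((i:ℝ) + 1) := hm i
    have hyi := hy0 i
    have hTy : 0 < T + y i := by linarith
    rw [h1, h0, Real.log_div hTy.ne' hi2.ne', Real.log_div hT0.ne' hi.ne']
    have hlog1 : y i / (T + y i) ≤ Real.log (T + y i) - Real.log T := by
      rw [← Real.log_div hTy.ne' hT0.ne']
      have := Real.one_sub_inv_le_log_of_pos (div_pos hTy hT0)
      refine le_trans (le_of_eq ?_) this
      field_simp; ring
    have hlog2 : ((i:ℝ) + 1) * (Real.log ((i:ℝ)+1+1) - Real.log ((i:ℝ)+1)) ≤ 1 := by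
      rw [← Real.log_div hi2.ne' hi.ne']
      have := Real.log_le_sub_one_of_pos (div_pos hi2 hi)
      calc _ ≤ ((i:ℝ) + 1) * (((i:ℝ)+1+1)/((i:ℝ)+1) - 1) := by gcongr
        _ = 1 := by field_simp; ring
    have hyT : y i / T ≤ C * (y i / (T + y i)) := by
      rw [div_le_iff₀ hT0]
      have : T + y i ≤ C * T := by
        have : y i ≤ B / c2 * T := by
          calc y i ≤ B := hyB i
            _ = B / c2 * c2 := by field_simp
            _ ≤ _ := by gcongr
        rw [hC]; linarith
      calc y i = (T + y i) * (y i / (T + y i)) := by field_simp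
        _ ≤ (C * T) * (y i / (T + y i)) := by gcongr
        _ = _ := by ring
    calc y i / (T / ((i:ℝ)+1)) = ((i:ℝ)+1) * (y i / T) := by field_simp
      _ ≤ ((i:ℝ)+1) * (C * (Real.log (T + y i) - Real.log T)) := by
        have := hyT.trans (mul_le_mul_of_nonneg_left hlog1 hC0.le)
        gcongr
      _ = C * (((i:ℝ)+1) * (Real.log (T + y i) - Real.log T)) := by ring
      _ ≤ _ := by
        gcongr
        linarith
  have hAbel : ∀ n : ℕ, ∑ i ∈ range n, y i / m i ≤
      C * (n + n * Real.log (m n) - ∑ i ∈ range n, Real.log (m i)) := by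
    intro n
    induction n with
    | zero => simp
    | succ n ih =>
      rw [Finset.sum_range_succ, Finset.sum_range_succ]
      have := hstep n
      push_cast
      calc _ ≤ _ := add_le_add ih this
        _ = _ := by ring
  have hlogm : ∀ i, -Real.log (m i) ≤ 4 * √(1 / √(m i)) := by
    intro i
    have hmi := hmpos i
    set v := √(1 / √(m i)) with hv
    have hv0 : 0 < v := by positivity
    have h4 : m i = (v^4)⁻¹ := by
      have h2 : v^2 = 1 / √(m i) := Real.sq_sqrt (by positivity)
      have : v^4 = (m i)⁻¹ := by
        rw [show v^4 = (v^2)^2 by ring, h2, div_pow, Real.sq_sqrt hmi.le]; simp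
      rw [this, inv_inv]
    rw [h4, Real.log_inv, Real.log_pow]
    have := Real.log_le_sub_one_of_pos hv0
    push_cast
    linarith
  have hAle : ∀ᶠ n in atTop, A n ≤ C * (1 + 4 * √(W n)) := by
    filter_upwards [eventually_gt_atTop 0, hmlim.eventually_lt_const one_pos] with n hn hmn
    have hn' : (0:ℝ) < n := by exact_mod_cast hn
    have hneg : Real.log (m n) ≤ 0 := Real.log_nonpos (hmpos n).le hmn.le
    have hCS : ∑ i ∈ range n, √(1 / √(m i)) ≤ n * √(W n) := by
      have h := sq_sum_le_card_mul_sum_sq (s := range n) (f := fun i => √(1 / √(m i)))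
      simp only [Finset.card_range] at h
      have h2 : ∑ i ∈ range n, √(1 / √(m i))^2 = n * W n := by
        simp only [hW]
        rw [mul_div_cancel₀ _ hn'.ne']
        exact Finset.sum_congr rfl fun i _ => Real.sq_sqrt (by positivity)
      rw [h2] at h
      refine abs_le_of_sq_le_sq' ?_ (by positivity) |>.2
      rw [mul_pow, Real.sq_sqrt (hWpos n hn).le]
      linarith
    have h3 : -∑ i ∈ range n, Real.log (m i) ≤ 4 * (n * √(W n)) := by
      rw [← Finset.sum_neg_distrib]
      calc _ ≤ ∑ i ∈ range n, 4 * √(1 / √(m i)) := Finset.sum_le_sum fun i _ => hlogm i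
        _ ≤ _ := by rw [← Finset.mul_sum]; linarith
    simp only [hAdef]
    rw [div_le_iff₀ hn']
    refine (hAbel n).trans ?_
    rw [mul_assoc]
    gcongr
    nlinarith
  set κ : ℝ := min √2 (c1 / √Lmax * √c2) with hκ
  have hc10 := hc1.1
  have hκ0 : 0 < κ := by rw [hκ, lt_min_iff]; constructor <;> positivity
  set G : ℝ := 2 / (1 - c1) with hG
  have hc1' : 0 < 1 - c1 := by linarith [hc1.2]
  have hG0 : 0 < G := by positivity
  have hbound : Tendsto (fun n => √Lmax / κ *
      ((1 + G * C) * (1 / W n) + 4 * G * C * √(1 / W n))) atTop (nhds 0) := by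
    have h2 : Tendsto (fun n => √(1 / W n)) atTop (nhds 0) := by simpa using hWinv.sqrt
    simpa using ((hWinv.const_mul (1 + G * C)).add (h2.const_mul (4 * G * C))).const_mul (√Lmax / κ)
  refine squeeze_zero' ?_ ?_ hbound
  · refine Eventually.of_forall fun n => ?_
    have h1 : 0 ≤ ∑ i ∈ range n, psiE (min √(2 * Ls n / (m i * n)) c1) * y i :=
      Finset.sum_nonneg fun i _ => mul_nonneg
        (aux_psi_nonneg ((min_le_right _ _).trans_lt hc1.2)) (hy0 i)
    have h2 : 0 ≤ ∑ i ∈ range n, min √(2 * Ls n / (m i * n)) c1 :=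
      Finset.sum_nonneg fun i _ => le_min (Real.sqrt_nonneg _) hc1.1.le
    have := hL0 n
    positivity
  · filter_upwards [eventually_gt_atTop 0, hAle] with n hn hAn
    have hn' : (0:ℝ) < n := by exact_mod_cast hn
    have hl := hL0 n
    have hs := Real.sqrt_pos.2 hl
    have hsn := Real.sqrt_pos.2 hn'
    have hnum : Ls n + ∑ i ∈ range n, psiE (min √(2 * Ls n / (m i * n)) c1) * y i ≤
        Ls n * (1 + G * A n) := by
      have : ∑ i ∈ range n, psiE (min √(2 * Ls n / (m i * n)) c1) * y i ≤
          ∑ i ∈ range n, Ls n * (G * (y i / m i / n)) := by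
        refine Finset.sum_le_sum fun i _ => ?_
        have hmi := hmpos i
        set s := √(2 * Ls n / (m i * n)) with hsdef
        have hs2 : s^2 = 2 * Ls n / (m i * n) := Real.sq_sqrt (by positivity)
        have h0 : 0 ≤ min s c1 := le_min (Real.sqrt_nonneg _) hc1.1.le
        have hle1 : min s c1 ≤ s := min_le_left _ _
        have hle2 : min s c1 ≤ c1 := min_le_right _ _
        calc psiE (min s c1) * y i ≤ (min s c1)^2 / (1 - min s c1) * y i :=
              mul_le_mul_of_nonneg_right (aux_psi_one h0 (hle2.trans_lt hc1.2)) (hy0 i)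
          _ ≤ s^2 / (1 - c1) * y i := by
              have := hy0 i
              gcongr
          _ = _ := by rw [hs2, hG]; field_simp
      rw [← Finset.mul_sum, ← Finset.mul_sum, ← Finset.sum_div] at this
      simp only [hAdef]
      linarith
    have hden : κ * √(Ls n) * √n * W n ≤ ∑ i ∈ range n, min √(2 * Ls n / (m i * n)) c1 := by
      have : κ * √(Ls n) * √n * W n = ∑ i ∈ range n, κ * √(Ls n) * (1 / √(m i)) / √n := by
        simp only [hW]
        rw [Finset.sum_div, Finset.mul_sum]
        refine Finset.sum_congr rfl fun i _ => ?_
        have hmi := Real.sqrt_pos.2 (hmpos i)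
        have : √(n:ℝ) * √n = n := Real.mul_self_sqrt hn'.le
        field_simp
        rw [sq, this]
      rw [this]
      refine Finset.sum_le_sum fun i hi => ?_
      have hmi := hmpos i
      have hmi' := Real.sqrt_pos.2 hmi
      have hin : (i:ℝ) + 1 ≤ n := by exact_mod_cast Finset.mem_range.1 hi
      refine le_min ?_ ?_
      · rw [Real.sqrt_div (by positivity), Real.sqrt_mul (by positivity), Real.sqrt_mul hmi.le]
        calc κ * √(Ls n) * (1 / √(m i)) / √n = κ * √(Ls n) / (√(m i) * √n) := by field_simp
          _ ≤ _ := by gcongr; exact min_le_left _ _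
      · have hcm : c2 ≤ m i * n := by
          have : c2 ≤ m i * ((i:ℝ)+1) := by
            rw [hm i, div_mul_cancel₀ _ (by positivity)]
            have := Finset.sum_nonneg (s := range i) (fun j _ => hy0 j); linarith
          nlinarith
        have hq : √c2 ≤ √(m i) * √n := by
          rw [← Real.sqrt_mul hmi.le]; exact Real.sqrt_le_sqrt hcm
        have hLL : √(Ls n) ≤ √Lmax := Real.sqrt_le_sqrt (hLm n)
        have hLm' := Real.sqrt_pos.2 hLmpos
        calc κ * √(Ls n) * (1 / √(m i)) / √n = κ * √(Ls n) / (√(m i) * √n) := by field_simp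
          _ ≤ (c1 / √Lmax * √c2) * √Lmax / √c2 := by
            gcongr
            exact min_le_right _ _
          _ = c1 := by field_simp
    have hw := hWpos n hn
    have hA0 : 0 ≤ A n := div_nonneg (Finset.sum_nonneg fun i _ =>
      div_nonneg (hy0 i) (hmpos i).le) hn'.le
    calc _ ≤ √(n:ℝ) * ((Ls n * (1 + G * A n)) / (κ * √(Ls n) * √n * W n)) := by
          gcongr
      _ = √(Ls n) / κ * ((1 + G * A n) / W n) := by
          have hss : √(Ls n) * √(Ls n) = Ls n := Real.mul_self_sqrt hl.le
          field_simp
          rw [sq, hss]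
      _ ≤ √Lmax / κ * ((1 + G * (C * (1 + 4 * √(W n)))) / W n) := by
          gcongr
          exact hLm n
      _ = _ := by
          rw [Real.sqrt_div zero_le_one, Real.sqrt_one]
          have hww := Real.sqrt_pos.2 hw
          have hss : √(W n) * √(W n) = W n := Real.mul_self_sqrt hw.le
          have : √(W n) / W n = 1 / √(W n) := by
            rw [div_eq_div_iff hw.ne' hww.ne', hss, one_mul]
          rw [← this]
          field_simp
          ring

lemma aux_slln {m0 : MeasurableSpace Ω} (P : Measure Ω) [IsProbabilityMeasure P]
    (ℱ : Filtration ℕ m0) (D : ℕ → Ω → ℝ) (C : ℝ)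
    (hmeas : ∀ i, Measurable[ℱ (i+1)] (D i))
    (hb : ∀ i, ∀ᵐ ω ∂P, |D i ω| ≤ C)
    (hc : ∀ i, P[D i|ℱ i] =ᵐ[P] 0) :
    ∀ᵐ ω ∂P, Tendsto (fun n : ℕ => (∑ i ∈ range n, D i ω) / n) atTop (nhds 0) := by
  set M : ℕ → Ω → ℝ := fun n ω => ∑ i ∈ range n, D i ω / ((i:ℝ)+1) with hM
  have hMs : ∀ n, M (n+1) = M n + fun ω => D n ω / ((n:ℝ)+1) := fun n => by
    ext ω; simp only [hM, Finset.sum_range_succ, Pi.add_apply]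
  have hDm : ∀ i, Measurable (D i) := fun i => (hmeas i).mono (ℱ.le _) le_rfl
  have hDtop : ∀ i, MemLp (D i) ⊤ P := fun i =>
    memLp_top_of_bound (hDm i).aestronglyMeasurable C (hb i)
  have hdtop : ∀ i : ℕ, MemLp (fun ω => D i ω / ((i:ℝ)+1)) ⊤ P := fun i => by
    have := (hDtop i).const_mul (1 / ((i:ℝ)+1))
    refine this.congr_norm (((hDm i).div_const _).aestronglyMeasurable) (ae_of_all _ fun ω => ?_)
    congr 1; ring
  have hMtop : ∀ n, MemLp (M n) ⊤ P := fun n => by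
    induction n with
    | zero =>
      have : M 0 = fun _ => 0 := by ext; simp [hM]
      rw [this]; exact memLp_const 0
    | succ n ih => rw [hMs]; exact ih.add (hdtop n)
  have hMmeas : ∀ n, Measurable[ℱ n] (M n) := fun n => by
    refine Finset.measurable_fun_sum _ fun i hi => ?_
    exact ((hmeas i).mono (ℱ.mono (Finset.mem_range.1 hi)) le_rfl).div_const _
  have hMsm : StronglyAdapted ℱ M := fun n => (hMmeas n).stronglyMeasurable
  have hMint : ∀ n, Integrable (M n) P := fun n => (hMtop n).integrable le_top
  have hdint : ∀ n : ℕ, Integrable (fun ω => D n ω / ((n:ℝ)+1)) P :=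
    fun n => (hdtop n).integrable le_top
  have hdc : ∀ n : ℕ, P[(fun ω => D n ω / ((n:ℝ)+1))|ℱ n] =ᵐ[P] 0 := fun n => by
    have h1 : (fun ω => D n ω / ((n:ℝ)+1)) = (1 / ((n:ℝ)+1)) • D n := by
      ext ω; simp only [Pi.smul_apply, smul_eq_mul]; ring
    rw [h1]
    refine (condExp_smul _ _ _).trans ?_
    filter_upwards [hc n] with ω hω
    simp [hω]
  have hmart : Martingale M ℱ P := by
    refine martingale_of_condExp_sub_eq_zero_nat hMsm hMint fun n => ?_
    rw [hMs, add_sub_cancel_left]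
    exact hdc n
  have hcross : ∀ n : ℕ, ∫ ω, M n ω * (D n ω / ((n:ℝ)+1)) ∂P = 0 := fun n => by
    have hi : Integrable (M n * fun ω => D n ω / ((n:ℝ)+1)) P :=
      ((hdtop n).mul (hMtop n) (r := ⊤)).integrable le_top
    have h1 := condExp_mul_of_stronglyMeasurable_left (hMsm n) hi (hdint n)
    have h2 : P[M n * (fun ω => D n ω / ((n:ℝ)+1))|ℱ n] =ᵐ[P] 0 := by
      refine h1.trans ?_
      filter_upwards [hdc n] with ω hω
      simp [hω]
    have h3 := integral_condExp (ℱ.le n) (f := M n * fun ω => D n ω / ((n:ℝ)+1)) (μ := P)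
    rw [integral_congr_ae h2] at h3
    simpa using h3.symm
  have hsq : ∀ {f g : Ω → ℝ}, MemLp f ⊤ P → MemLp g ⊤ P → Integrable (fun ω => f ω * g ω) P :=
    fun hf hg => (hg.mul hf (r := ⊤)).integrable le_top
  have hE : ∀ n, ∫ ω, M n ω ^ 2 ∂P ≤ C^2 * ∑ i ∈ range n, 1 / ((i:ℝ)+1)^2 := fun n => by
    induction n with
    | zero => simp [hM]
    | succ n ih =>
      have e1 : (fun ω => M (n+1) ω ^ 2) = fun ω => (M n ω * M n ω +
          2 * (M n ω * (D n ω / ((n:ℝ)+1)))) +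
          (D n ω / ((n:ℝ)+1)) * (D n ω / ((n:ℝ)+1)) := by
        ext ω; rw [hMs]; simp only [Pi.add_apply]; ring
      have i1 := hsq (hMtop n) (hMtop n)
      have i2 := (hsq (hMtop n) (hdtop n)).const_mul 2
      have i3 := hsq (hdtop n) (hdtop n)
      have i12 : Integrable (fun ω => M n ω * M n ω + 2 * (M n ω * (D n ω / ((n:ℝ)+1)))) P :=
        i1.add i2
      rw [e1, integral_add i12 i3, integral_add i1 i2, integral_const_mul, hcross,
        Finset.sum_range_succ, mul_add]
      have h3 : ∫ ω, (D n ω / ((n:ℝ)+1)) * (D n ω / ((n:ℝ)+1)) ∂P ≤ C^2 * (1 / ((n:ℝ)+1)^2) := by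
        have : ∫ ω, (D n ω / ((n:ℝ)+1)) * (D n ω / ((n:ℝ)+1)) ∂P ≤
            ∫ _ω, C^2 * (1 / ((n:ℝ)+1)^2) ∂P := by
          refine integral_mono_ae i3 (integrable_const _) ?_
          filter_upwards [hb n] with ω hω
          have : D n ω ^ 2 ≤ C^2 := sq_le_sq' (by linarith [(abs_le.1 hω).1]) (abs_le.1 hω).2
          calc (D n ω / ((n:ℝ)+1)) * (D n ω / ((n:ℝ)+1)) = D n ω ^ 2 * (1 / ((n:ℝ)+1)^2) := by field_simp
            _ ≤ _ := by gcongr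
        simpa using this
      have e2 : ∫ ω, M n ω * M n ω ∂P = ∫ ω, M n ω ^ 2 ∂P := by simp only [sq]
      rw [e2]
      linarith
  have hsum : Summable (fun i : ℕ => 1 / ((i:ℝ)+1)^2) := by
    have := (summable_nat_add_iff 1).2 (Real.summable_one_div_nat_pow.2 (one_lt_two))
    simpa using this
  set K := 1 + C^2 * ∑' i : ℕ, 1 / ((i:ℝ)+1)^2 with hK
  have hbd : ∀ n, eLpNorm (M n) 1 P ≤ (K.toNNReal : ENNReal) := fun n => by
    rw [eLpNorm_one_eq_lintegral_enorm, ← ofReal_integral_norm_eq_lintegral_enorm (hMint n)]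
    apply ENNReal.ofReal_le_ofReal
    have h1 : ∫ ω, ‖M n ω‖ ∂P ≤ ∫ ω, (1 + M n ω ^ 2) ∂P := by
      have i1 : Integrable (fun ω => M n ω ^ 2) P := by
        simpa only [sq] using hsq (hMtop n) (hMtop n)
      refine integral_mono (hMint n).norm ((integrable_const _).add i1) fun ω => ?_
      simp only [Real.norm_eq_abs]
      rw [← sq_abs]
      nlinarith [sq_nonneg (|M n ω| - 1), abs_nonneg (M n ω)]
    have i1 : Integrable (fun ω => M n ω ^ 2) P := by
      simpa only [sq] using hsq (hMtop n) (hMtop n)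
    rw [integral_add (integrable_const _) i1] at h1
    simp only [integral_const, probReal_univ, smul_eq_mul, mul_one] at h1
    have h2 : ∑ i ∈ range n, 1 / ((i:ℝ)+1)^2 ≤ ∑' i : ℕ, 1 / ((i:ℝ)+1)^2 :=
      hsum.sum_le_tsum _ fun i _ => by positivity
    have := mul_le_mul_of_nonneg_left h2 (sq_nonneg C)
    have := hE n
    linarith
  filter_upwards [hmart.submartingale.exists_ae_tendsto_of_bdd hbd] with ω hω
  obtain ⟨c, hcω⟩ := hω
  have h := hcω.sub (aux_cesaro hcω)
  rw [sub_self] at h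
  refine h.congr' ?_
  have hk : ∀ n : ℕ, ∑ i ∈ range n, D i ω = n * M n ω - ∑ i ∈ range n, M i ω := fun n => by
    induction n with
    | zero => simp
    | succ n ih =>
      rw [Finset.sum_range_succ, ih, Finset.sum_range_succ, hMs]
      simp only [Pi.add_apply]
      push_cast
      have : (n:ℝ) + 1 ≠ 0 := by positivity
      field_simp
      ring
  filter_upwards [eventually_gt_atTop 0] with n hn
  have : (n:ℝ) ≠ 0 := by positivity
  rw [hk]
  field_simp

/-- The law of large numbers around a constant conditional mean. -/
lemma aux_slln_const {m0 : MeasurableSpace Ω} (P : Measure Ω) [IsProbabilityMeasure P]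
    (ℱ : Filtration ℕ m0) (D : ℕ → Ω → ℝ) (C l : ℝ)
    (hmeas : ∀ i, Measurable[ℱ (i+1)] (D i))
    (hb : ∀ i, ∀ᵐ ω ∂P, |D i ω| ≤ C)
    (hc : ∀ i, P[D i|ℱ i] =ᵐ[P] fun _ => l) :
    ∀ᵐ ω ∂P, Tendsto (fun n : ℕ => (∑ i ∈ range n, D i ω) / n) atTop (nhds l) := by
  have h := aux_slln P ℱ (fun i ω => D i ω - l) (C + |l|) (fun i => (hmeas i).sub_const l)
    (fun i => by
      filter_upwards [hb i] with ω hω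
      exact (abs_sub _ _).trans (by linarith))
    (fun i => by
      have hint : Integrable (D i) P := Integrable.of_bound
        (((hmeas i).mono (ℱ.le _) le_rfl).aestronglyMeasurable) C (hb i)
      have h1 := condExp_sub hint (integrable_const l) (ℱ i)
      refine Filter.EventuallyEq.trans h1 ?_
      filter_upwards [hc i] with ω hω
      simp [condExp_const (ℱ.le i), hω])
  filter_upwards [h] with ω hω
  have := hω.add_const l
  rw [zero_add] at this
  refine this.congr' ?_
  filter_upwards [eventually_gt_atTop 0] with n hn
  have : (n:ℝ) ≠ 0 := by positivity
  simp only [Finset.sum_sub_distrib, Finset.sum_const, Finset.card_range, nsmul_eq_mul]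
  field_simp
  ring

lemma aux_Icc (f : ℕ → ℝ) (n : ℕ) : ∑ i ∈ Finset.Icc 1 n, f i = ∑ i ∈ range n, f (i+1) := by
  induction n with
  | zero => simp
  | succ n ih => rw [Finset.sum_Icc_succ_top (by omega), ih, Finset.sum_range_succ]

lemma aux_sq {a b : ℕ → ℝ} {K : ℝ} (ha : ∀ i, |a i| ≤ K) (hb : ∀ i, |b i| ≤ K)
    (h : Tendsto (fun i => a i - b i) atTop (nhds 0)) :
    Tendsto (fun i => a i ^ 2 - b i ^ 2) atTop (nhds 0) := by
  have h3 : Tendsto (fun i => |a i - b i| * (2 * K)) atTop (nhds 0) := by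
    simpa using h.abs.mul_const (2 * K)
  refine squeeze_zero_norm (fun i => ?_) h3
  rw [Real.norm_eq_abs, show a i ^ 2 - b i ^ 2 = (a i - b i) * (a i + b i) by ring, abs_mul]
  refine mul_le_mul_of_nonneg_left ?_ (abs_nonneg _)
  have := abs_add_le (a i) (b i)
  linarith [ha i, hb i]

lemma aux_bdd {a : ℕ → ℝ} {l : ℝ} (h : Tendsto a atTop (nhds l)) : ∃ K, ∀ i, |a i| ≤ K := by
  obtain ⟨K, hK⟩ := h.abs.bddAbove_range
  exact ⟨K, fun i => hK ⟨i, rfl⟩⟩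

/-- Theorem 6 of the paper: `√n · R_{n,δ_n} → √(2 V log(1/δ))` almost surely. -/
theorem sqrt_n_R_tendsto
    {m0 : MeasurableSpace Ω} (P : Measure Ω) [IsProbabilityMeasure P]
    (ℱ : Filtration ℕ m0) (X : ℕ → Ω → ℝ) (μ σ2 V δ : ℝ) (δseq : ℕ → ℝ)
    (c1 c2 c3 c4 : ℝ)
    (hc1 : c1 ∈ Set.Ioo (0:ℝ) 1) (hc2 : c2 ∈ Set.Ioc (0:ℝ) 1)
    (hc3 : c3 ∈ Set.Ioc (0:ℝ) 1) (hc4 : c4 ∈ Set.Icc (0:ℝ) 1)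
    (hadapt : Adapted ℱ X)
    (hint : ∀ t, 1 ≤ t → Integrable (X t) P)
    (hbdd : ∀ t, 1 ≤ t → ∀ᵐ ω ∂P, X t ω ∈ Set.Icc (0:ℝ) 1)
    (hmean : ∀ t, 1 ≤ t → P[X t|ℱ (t - 1)] =ᵐ[P] fun _ => μ)
    (hvar : ∀ t, 1 ≤ t → P[(fun ω => (X t ω - μ)^2)|ℱ (t - 1)] =ᵐ[P] fun _ => σ2)
    (hvar4 : ∀ t, 1 ≤ t →
      P[(fun ω => ((X t ω - μ)^2 - σ2)^2)|ℱ (t - 1)] =ᵐ[P] fun _ => V)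
    (hδpos : ∀ n, 0 < δseq n) (hδmono : Monotone δseq)
    (hδlim : Tendsto δseq atTop (nhds δ)) (hδ : 0 < δ) :
    ∀ᵐ ω ∂P, Tendsto
      (fun n : ℕ => Real.sqrt n * RB c1 c2 c3 c4 X (δseq n) n ω)
      atTop (nhds (Real.sqrt (2 * V * Real.log (1/δ)))) := by
  have hX : ∀ i, Measurable[ℱ (i+1)] (X (i+1)) := fun i => hadapt (i+1)
  have hX2 : ∀ i, Measurable[ℱ (i+1)] (fun ω => (X (i+1) ω - μ)^2) := fun i =>
    ((hX i).sub_const μ).pow_const 2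
  have hX4 : ∀ i, Measurable[ℱ (i+1)] (fun ω => ((X (i+1) ω - μ)^2 - σ2)^2) := fun i =>
    ((hX2 i).sub_const σ2).pow_const 2
  have h1 := aux_slln_const P ℱ (fun i => X (i+1)) 1 μ hX
    (fun i => by
      filter_upwards [hbdd (i+1) (by omega)] with ω hω
      rw [abs_le]; constructor <;> linarith [hω.1, hω.2])
    (fun i => hmean (i+1) (by omega))
  have hb1 : ∀ x : ℝ, x ∈ Set.Icc (0:ℝ) 1 → |x - μ| ≤ 1 + |μ| := fun x hx => by
    refine (abs_sub _ _).trans ?_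
    have : |x| ≤ 1 := by rw [abs_le]; constructor <;> linarith [hx.1, hx.2]
    linarith
  have hb2 : ∀ x : ℝ, x ∈ Set.Icc (0:ℝ) 1 → |(x - μ)^2| ≤ (1 + |μ|)^2 := fun x hx => by
    rw [abs_pow]
    exact pow_le_pow_left₀ (abs_nonneg _) (hb1 x hx) 2
  have hb3 : ∀ x : ℝ, x ∈ Set.Icc (0:ℝ) 1 → |(x - μ)^2 - σ2| ≤ (1 + |μ|)^2 + |σ2| := fun x hx =>
    (abs_sub _ _).trans (by linarith [hb2 x hx])
  have h2 := aux_slln_const P ℱ (fun i ω => (X (i+1) ω - μ)^2) ((1 + |μ|)^2) σ2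
    hX2
    (fun i => by
      filter_upwards [hbdd (i+1) (by omega)] with ω hω
      exact hb2 _ hω)
    (fun i => hvar (i+1) (by omega))
  have h3 := aux_slln_const P ℱ (fun i ω => ((X (i+1) ω - μ)^2 - σ2)^2)
    (((1 + |μ|)^2 + |σ2|)^2) V
    hX4
    (fun i => by
      filter_upwards [hbdd (i+1) (by omega)] with ω hω
      rw [abs_pow]
      exact pow_le_pow_left₀ (abs_nonneg _) (hb3 _ hω) 2)
    (fun i => hvar4 (i+1) (by omega))
  have h0 : ∀ᵐ ω ∂P, ∀ i : ℕ, X (i+1) ω ∈ Set.Icc (0:ℝ) 1 :=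
    ae_all_iff.2 fun i => hbdd (i+1) (by omega)
  filter_upwards [h0, h1, h2, h3] with ω h0 h1 h2 h3
  have hc20 := hc2.1
  have hV0 : 0 ≤ V := ge_of_tendsto' h3 fun n =>
    div_nonneg (Finset.sum_nonneg fun i _ => sq_nonneg _) (Nat.cast_nonneg n)
  -- trivial case: some `δ_N ≥ 1`
  by_cases hbig : ∃ N, 1 ≤ δseq N
  · obtain ⟨N, hN⟩ := hbig
    have hδ1 : 1 ≤ δ := hN.trans (hδmono.ge_of_tendsto hδlim N)
    have hlog : Real.log (1/δ) ≤ 0 :=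
      Real.log_nonpos (by positivity) ((div_le_one hδ).2 hδ1)
    rw [Real.sqrt_eq_zero_of_nonpos (mul_nonpos_of_nonneg_of_nonpos (by positivity) hlog)]
    refine tendsto_const_nhds.congr' ?_
    filter_upwards [eventually_ge_atTop N] with n hn
    have hd1 : 1 ≤ δseq n := hN.trans (hδmono hn)
    have hlogn : Real.log (1/δseq n) ≤ 0 :=
      Real.log_nonpos (one_div_nonneg.2 (hδpos n).le) ((div_le_one (hδpos n)).2 hd1)
    have hlam : ∀ i, lamB c1 c2 c3 c4 X (δseq n) n i ω = 0 := fun i => by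
      unfold lamB
      have hm : 0 ≤ m4Hat2 c2 c3 c4 X i ω := by
        unfold m4Hat2
        have := Finset.sum_nonneg (s := Finset.Icc 1 (i-1))
          (f := fun i => ((X i ω - muHat c4 X i ω)^2 - sigHat2 c3 c4 X i ω)^2)
          (fun j _ => sq_nonneg _)
        positivity
      rw [Real.sqrt_eq_zero_of_nonpos, min_eq_left hc1.1.le]
      exact div_nonpos_of_nonpos_of_nonneg (by linarith) (by positivity)
    unfold RB
    simp [hlam]
  push Not at hbig
  -- convergence of the estimators
  have hmu : Tendsto (fun n => muHat c4 X (n+1) ω) atTop (nhds μ) := by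
    refine (aux_shift (c := c4) h1).congr fun n => ?_
    unfold muHat
    rw [Nat.add_sub_cancel, aux_Icc]; push_cast; rfl
  obtain ⟨K1, hK1⟩ := aux_bdd hmu
  have hb4 : ∀ i, |X (i+1) ω - muHat c4 X (i+1) ω| ≤ 1 + K1 + |μ| := fun i => by
    refine (abs_sub _ _).trans ?_
    have : |X (i+1) ω| ≤ 1 := by rw [abs_le]; constructor <;> linarith [(h0 i).1, (h0 i).2]
    linarith [hK1 i, abs_nonneg μ]
  have hK10 : 0 ≤ K1 := (abs_nonneg _).trans (hK1 0)
  have hz : Tendsto (fun i => (X (i+1) ω - muHat c4 X (i+1) ω)^2 - (X (i+1) ω - μ)^2)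
      atTop (nhds 0) := by
    refine aux_sq hb4 (fun i => (hb1 _ (h0 i)).trans (by linarith)) ?_
    have := hmu.const_sub μ
    rw [sub_self] at this
    exact this.congr fun i => by ring
  have hsig : Tendsto (fun n => sigHat2 c3 c4 X (n+1) ω) atTop (nhds σ2) := by
    refine (aux_shift (c := c3) (aux_cesaro_perturb h2 hz)).congr fun n => ?_
    unfold sigHat2
    rw [Nat.add_sub_cancel, aux_Icc]; push_cast; rfl
  obtain ⟨K2, hK2⟩ := aux_bdd hsig
  have hK20 : 0 ≤ K2 := (abs_nonneg _).trans (hK2 0)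
  set K3 := (1 + K1 + |μ|)^2 + K2 + |σ2| with hK3
  have hb5 : ∀ i, |(X (i+1) ω - muHat c4 X (i+1) ω)^2 - sigHat2 c3 c4 X (i+1) ω| ≤ K3 :=
    fun i => by
      refine (abs_sub _ _).trans ?_
      rw [abs_pow]
      have := pow_le_pow_left₀ (abs_nonneg _) (hb4 i) 2
      linarith [hK2 i, abs_nonneg σ2]
  set y : ℕ → ℝ := fun i =>
    ((X (i+1) ω - muHat c4 X (i+1) ω)^2 - sigHat2 c3 c4 X (i+1) ω)^2 with hy
  have hav : Tendsto (fun n : ℕ => (∑ i ∈ range n, y i) / n) atTop (nhds V) := by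
    refine aux_cesaro_perturb h3 ?_
    refine aux_sq hb5 (fun i => (hb3 _ (h0 i)).trans ?_) ?_
    · have : (1 + |μ|)^2 ≤ (1 + K1 + |μ|)^2 :=
        pow_le_pow_left₀ (by positivity) (by linarith) 2
      linarith
    · have := hz.sub (hsig.sub_const σ2)
      rw [sub_self, sub_self] at this
      exact this.congr fun i => by ring
  have hyB : ∀ i, y i ≤ K3^2 := fun i => by
    simp only [hy]
    rw [← sq_abs]
    exact pow_le_pow_left₀ (abs_nonneg _) (hb5 i) 2
  have hy0 : ∀ i, 0 ≤ y i := fun i => sq_nonneg _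
  have hm : ∀ i : ℕ, m4Hat2 c2 c3 c4 X (i+1) ω = (c2 + ∑ j ∈ range i, y j) / ((i:ℝ) + 1) :=
    fun i => by
      unfold m4Hat2
      rw [Nat.add_sub_cancel, aux_Icc]; push_cast; rfl
  have hL0 : ∀ n, 0 < Real.log (1/δseq n) := fun n =>
    Real.log_pos ((one_lt_div (hδpos n)).2 (hbig n))
  have hLm : ∀ n, Real.log (1/δseq n) ≤ Real.log (1/δseq 0) := fun n =>
    Real.log_le_log (one_div_pos.2 (hδpos n))
      (one_div_le_one_div_of_le (hδpos 0) (hδmono (Nat.zero_le n)))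
  have hL : Tendsto (fun n => Real.log (1/δseq n)) atTop (nhds (Real.log (1/δ))) :=
    (tendsto_const_nhds.div hδlim hδ.ne').log (by positivity)
  have hRB : ∀ n, RB c1 c2 c3 c4 X (δseq n) n ω =
      (Real.log (1/δseq n) + ∑ i ∈ range n,
        psiE (min √(2 * Real.log (1/δseq n) / (m4Hat2 c2 c3 c4 X (i+1) ω * n)) c1) * y i) /
        ∑ i ∈ range n, min √(2 * Real.log (1/δseq n) / (m4Hat2 c2 c3 c4 X (i+1) ω * n)) c1 :=
    fun n => by
      unfold RB
      rw [aux_Icc, aux_Icc]; rfl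
  simp only [hRB]
  rcases hV0.eq_or_lt with hV | hV
  · subst hV
    rw [mul_zero, zero_mul, Real.sqrt_zero]
    exact aux_zero hc1 hc20 hy0 hyB hav hm hL0 hLm
  · exact aux_pos hc1 hc20 hy0 hyB hav hm hL0 hLm hL hV
end
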